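/- Let r and s be coprime integers with 2 ≤ r < s, g = (r−1)(s−1)/2, N the increasing enumeration of the numerical semigroup generated by r and s, and Λ_i = g − N(i−1) + (i−1) for i = 1, …, g. Then there exists a polynomial P ∈ ℚ[X_1, …, X_g] such that, as an identity in ℚ[t_1, …, t_g], the Schur polynomial s_Λ(t_1, …, t_g) equals P evaluated at X_i = T_{Λ_i+g−i}(t_1, …, t_g) for i = 1, …, g, where T_w(t_1, …, t_g) = (1/w)·Σ_{j=1}^{g} t_j^w. In other words, s_Λ is a polynomial in the power sums T_w with w ranging over the numbers Λ_i + g − i (the Weierstrass gaps). -/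

import Mathlib

/-- Membership in the numerical semigroup generated by `r` and `s`. -/
def inSg (r s n : ℕ) : Prop := ∃ a b : ℕ, n = a * r + b * s

/-- The Young diagram row lengths `Λ i = g - N(i-1) + (i-1)` attached to the
Weierstrass gap sequence. -/
def Lam (g : ℕ) (N : ℕ → ℕ) (i : ℕ) : ℕ := g + (i - 1) - N (i - 1)

/-- The normalized power sum `T_w(t_1, …, t_m) = (1/w)·Σ_{j=1}^m t_j^w`. -/
noncomputable def Tpow (m w : ℕ) : MvPolynomial ℕ ℚ :=
  ((w : ℚ))⁻¹ • ∑ j ∈ Finset.Icc 1 m, MvPolynomial.X j ^ w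

/-- The Vandermonde product `∏_{1 ≤ i < j ≤ m} (t_i - t_j)`. -/
noncomputable def vand (m : ℕ) : MvPolynomial ℕ ℚ :=
  ∏ j ∈ Finset.Icc 1 m, ∏ i ∈ Finset.Ico 1 j,
    (MvPolynomial.X i - MvPolynomial.X j)

/-- The matrix `(t_j^{μ_i + m - i})_{1 ≤ i, j ≤ m}` whose determinant defines
the Schur polynomial of `μ` in `m` variables. -/
noncomputable def tMat (m : ℕ) (μ : ℕ → ℕ) :
    Matrix (Fin m) (Fin m) (MvPolynomial ℕ ℚ) :=
  Matrix.of fun i j =>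
    MvPolynomial.X (j.val + 1) ^ (μ (i.val + 1) + m - (i.val + 1))

section LogDerivative

open PowerSeries

variable {R : Type*} [CommRing R]

theorem coeff_X_mul_derivative (F : PowerSeries R) (n : ℕ) :
    coeff n (X * derivative R F) = n * coeff n F := by
  cases n with
  | zero => simp
  | succ n =>
    rw [coeff_succ_X_mul, coeff_derivative]
    push_cast
    ring

theorem X_mul_derivative_mul {a b F G : PowerSeries R} (hF : X * derivative R F = a * F)
    (hG : X * derivative R G = b * G) :
    X * derivative R (F * G) = (a + b) * (F * G) := by
  rw [Derivation.leibniz, smul_eq_mul, smul_eq_mul]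
  linear_combination F * hG + G * hF

theorem X_mul_derivative_prod {ι : Type*} (s : Finset ι) {a F : ι → PowerSeries R}
    (h : ∀ i, X * derivative R (F i) = a i * F i) :
    X * derivative R (∏ i ∈ s, F i) = (∑ i ∈ s, a i) * ∏ i ∈ s, F i := by
  classical
  induction s using Finset.induction_on with
  | empty => simp
  | insert i s hi ih =>
    rw [Finset.prod_insert hi, Finset.sum_insert hi]
    exact X_mul_derivative_mul (h i) ih

variable [Algebra ℚ R]

theorem coeff_of_X_mul_derivative_eq {a F : PowerSeries R} (hF : X * derivative R F = a * F)
    {n : ℕ} (hn : n ≠ 0) :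
    coeff n F =
      (n : ℚ)⁻¹ • ∑ p ∈ Finset.HasAntidiagonal.antidiagonal n, coeff p.1 a * coeff p.2 F := by
  have h := congrArg (coeff n) hF
  rw [coeff_X_mul_derivative, coeff_mul] at h
  rw [← h, ← nsmul_eq_mul, ← Nat.cast_smul_eq_nsmul ℚ, smul_smul,
    inv_mul_cancel₀ (Nat.cast_ne_zero.mpr hn), one_smul]

theorem eq_of_X_mul_derivative_eq {a F G : PowerSeries R} (ha : coeff 0 a = 0)
    (hF : X * derivative R F = a * F) (hG : X * derivative R G = a * G)
    (h0 : coeff 0 F = coeff 0 G) : F = G := by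
  ext n
  induction n using Nat.strong_induction_on with
  | _ n ih =>
    rcases eq_or_ne n 0 with rfl | hn
    · exact h0
    rw [coeff_of_X_mul_derivative_eq hF hn, coeff_of_X_mul_derivative_eq hG hn]
    congr 1
    refine Finset.sum_congr rfl fun p hp => ?_
    rw [Finset.HasAntidiagonal.mem_antidiagonal] at hp
    rcases eq_or_ne p.1 0 with h | h
    · rw [h, ha, zero_mul, zero_mul]
    · rw [ih p.2 (by omega)]

/-- The coefficients of the power series with constant term `1` and logarithmic derivative
`a / X`. -/
noncomputable def logDerivSolution (a : PowerSeries R) : ℕ → R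
  | 0 => 1
  | n + 1 => ((n + 1 : ℕ) : ℚ)⁻¹ • ∑ i : Fin (n + 1), coeff (n + 1 - i) a * logDerivSolution a i

theorem exists_X_mul_derivative_eq (a : PowerSeries R) (ha : coeff 0 a = 0) :
    ∃ F : PowerSeries R, coeff 0 F = 1 ∧ X * derivative R F = a * F := by
  refine ⟨mk (logDerivSolution a), by rw [coeff_mk, logDerivSolution], ?_⟩
  ext n
  rw [coeff_X_mul_derivative, coeff_mk, coeff_mul]
  cases n with
  | zero => simp [-coeff_zero_eq_constantCoeff, ha]
  | succ n =>
    rw [logDerivSolution, ← nsmul_eq_mul, ← Nat.cast_smul_eq_nsmul ℚ, smul_smul,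
      mul_inv_cancel₀ (Nat.cast_ne_zero.mpr n.succ_ne_zero), one_smul,
      ← Finset.Nat.sum_antidiagonal_swap,
      Finset.Nat.sum_antidiagonal_eq_sum_range_succ_mk, Finset.sum_range_succ,
      Fin.sum_univ_eq_sum_range (fun i => coeff (n + 1 - i) a * logDerivSolution a i)]
    simp [-coeff_zero_eq_constantCoeff, ha]

theorem coeff_mem_of_X_mul_derivative_eq {a F : PowerSeries R} (A : Subalgebra ℚ R)
    (hF : X * derivative R F = a * F) (ha0 : coeff 0 a = 0) (h0 : coeff 0 F = 1)
    (ha : ∀ n, coeff n a ∈ A) (n : ℕ) : coeff n F ∈ A := by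
  induction n using Nat.strong_induction_on with
  | _ n ih =>
    rcases eq_or_ne n 0 with rfl | hn
    · rw [h0]
      exact A.one_mem
    rw [coeff_of_X_mul_derivative_eq hF hn]
    refine A.smul_mem (A.sum_mem fun p hp => ?_) _
    rw [Finset.HasAntidiagonal.mem_antidiagonal] at hp
    rcases eq_or_ne p.1 0 with h | h
    · rw [h, ha0, zero_mul]
      exact A.zero_mem
    · exact A.mul_mem (ha _) (ih _ (by omega))

theorem coeff_eq_zero_of_X_mul_derivative_eq {a F : PowerSeries R} (S : AddSubmonoid ℕ)
    (hF : X * derivative R F = a * F) (ha0 : coeff 0 a = 0)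
    (ha : ∀ n ∉ S, coeff n a = 0) (n : ℕ) (hn : n ∉ S) : coeff n F = 0 := by
  induction n using Nat.strong_induction_on with
  | _ n ih =>
    rw [coeff_of_X_mul_derivative_eq hF (ne_of_mem_of_not_mem S.zero_mem hn).symm,
      Finset.sum_eq_zero, smul_zero]
    intro p hp
    rw [Finset.HasAntidiagonal.mem_antidiagonal] at hp
    by_cases h1 : p.1 ∈ S
    · by_cases h2 : p.2 ∈ S
      · exact absurd (hp ▸ S.add_mem h1 h2) hn
      · rcases eq_or_ne p.1 0 with h | h
        · rw [h, ha0, zero_mul]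
        · rw [ih _ (by omega) h2, mul_zero]
    · rw [ha _ h1, zero_mul]

end LogDerivative

section Alternant

open PowerSeries

variable {R : Type*} [CommRing R]

/-- The matrix whose row `i` lists the coefficients of `F` of index
`w i - (m - 1), …, w i - 1, w i`. -/
noncomputable def coeffMatrix {m : ℕ} (F : PowerSeries R) (w : Fin m → ℕ) :
    Matrix (Fin m) (Fin m) R :=
  Matrix.of fun i c => coeff (w i) (F * X ^ (c.rev : ℕ))

theorem det_coeffMatrix_rev {m : ℕ} {F : PowerSeries R} (h0 : coeff 0 F = 1) :
    (coeffMatrix F fun i : Fin m => (i.rev : ℕ)).det = 1 := by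
  rw [Matrix.det_of_isUpperTriangular]
  · refine Finset.prod_eq_one fun i _ => ?_
    rw [coeffMatrix, Matrix.of_apply, coeff_mul_X_pow', if_pos le_rfl, Nat.sub_self, h0]
  · intro i j hij
    have hij : j < i := hij
    rw [coeffMatrix, Matrix.of_apply, coeff_mul_X_pow', if_neg]
    rw [not_le, Fin.val_fin_lt, Fin.rev_lt_rev]
    exact hij

theorem geometric_mul_one_sub (x : R) : mk (fun n => x ^ n) * (1 - C x * X) = 1 := by
  ext n
  cases n with
  | zero => simp
  | succ n =>
    rw [mul_sub, mul_one, mul_left_comm, map_sub, coeff_C_mul, coeff_succ_mul_X]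
    simp [coeff_one, pow_succ']

theorem X_mul_derivative_geometric (x : R) :
    X * derivative R (mk fun n => x ^ n) =
      mk (fun n => if n = 0 then 0 else x ^ n) * mk fun n => x ^ n := by
  ext n
  rw [coeff_X_mul_derivative, coeff_mul, Finset.Nat.sum_antidiagonal_eq_sum_range_succ_mk,
    Finset.sum_range_succ']
  simp only [coeff_mk, Nat.add_one_ne_zero, if_false, if_true, zero_mul, add_zero]
  rw [Finset.sum_congr rfl (g := fun _ => x ^ n), Finset.sum_const, Finset.card_range,
    nsmul_eq_mul]
  intro k hk
  rw [← pow_add, Nat.add_sub_cancel' (Finset.mem_range.mp hk)]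

theorem alternant_eq_coeffMatrix_mul {m : ℕ} {t : Fin m → R} {E : PowerSeries R}
    {Q : Fin m → Polynomial R} (hQ : ∀ j, (Q j).natDegree < m)
    (hE : ∀ j, E * (Q j : PowerSeries R) = mk fun n => t j ^ n) (w : Fin m → ℕ) :
    (Matrix.of fun i j => t j ^ w i : Matrix (Fin m) (Fin m) R) =
      coeffMatrix E w * Matrix.of fun c j => (Q j).coeff c.rev := by
  ext i j
  have h : (Q j : PowerSeries R) = ∑ c : Fin m, X ^ (c.rev : ℕ) * C ((Q j).coeff c.rev) := by
    have hrev := Equiv.sum_comp Fin.revPerm fun c : Fin m =>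
      (X ^ (c : ℕ) * C ((Q j).coeff c) : PowerSeries R)
    simp only [Fin.revPerm_apply] at hrev
    rw [hrev, Fin.sum_univ_eq_sum_range fun c => (X ^ c * C ((Q j).coeff c) : PowerSeries R)]
    conv_lhs => rw [(Q j).as_sum_range' m (hQ j)]
    rw [← Polynomial.coeToPowerSeries.ringHom_apply, map_sum]
    refine Finset.sum_congr rfl fun c _ => ?_
    rw [← Polynomial.C_mul_X_pow_eq_monomial, map_mul, map_pow]
    simp [mul_comm]
  have h' := congrArg (coeff (w i)) (hE j)
  rw [coeff_mk, h, Finset.mul_sum, map_sum] at h'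
  rw [Matrix.mul_apply, Matrix.of_apply, ← h']
  refine Finset.sum_congr rfl fun c _ => ?_
  rw [← mul_assoc, coeff_mul_C, coeffMatrix, Matrix.of_apply, Matrix.of_apply]

theorem exists_det_alternant_eq {m : ℕ} (t : Fin m → R) :
    ∃ E : PowerSeries R, coeff 0 E = 1 ∧
      X * derivative R E = mk (fun n => if n = 0 then 0 else ∑ j, t j ^ n) * E ∧
      ∀ w : Fin m → ℕ, (Matrix.of fun i j => t j ^ w i : Matrix (Fin m) (Fin m) R).det =
        (coeffMatrix E w).det * ∏ i, ∏ j ∈ Finset.Ioi i, (t i - t j) := by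
  classical
  set E : PowerSeries R := ∏ j, mk fun n => t j ^ n with hEdef
  set Q : Fin m → Polynomial R := fun j =>
    ∏ l ∈ Finset.univ.erase j, (1 - Polynomial.C (t l) * Polynomial.X) with hQdef
  have h0 : coeff 0 E = 1 := by
    rw [coeff_zero_eq_constantCoeff, hEdef, map_prod]
    exact Finset.prod_eq_one fun j _ => by simp [← coeff_zero_eq_constantCoeff_apply]
  have hQ : ∀ j, (Q j).natDegree < m := by
    intro j
    have hlin : ∀ l ∈ Finset.univ.erase j,
        (1 - Polynomial.C (t l) * Polynomial.X).natDegree ≤ 1 := fun l _ =>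
      (Polynomial.natDegree_sub_le _ _).trans
        (max_le (by simp) ((Polynomial.natDegree_C_mul_le _ _).trans Polynomial.natDegree_X_le))
    have := (Polynomial.natDegree_prod_le (Finset.univ.erase j)
      fun l => 1 - Polynomial.C (t l) * Polynomial.X).trans (Finset.sum_le_card_nsmul _ _ 1 hlin)
    rw [Finset.card_erase_of_mem (Finset.mem_univ j), Finset.card_univ, Fintype.card_fin,
      smul_eq_mul, mul_one] at this
    have := j.pos
    simp only [hQdef]
    omega
  have hE : ∀ j, E * (Q j : PowerSeries R) = mk fun n => t j ^ n := by
    intro j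
    have hcoe : (Q j : PowerSeries R) = ∏ l ∈ Finset.univ.erase j, (1 - C (t l) * X) := by
      rw [← Polynomial.coeToPowerSeries.ringHom_apply, map_prod]
      simp
    rw [hcoe, hEdef, ← Finset.mul_prod_erase _ _ (Finset.mem_univ j), mul_assoc,
      ← Finset.prod_mul_distrib, Finset.prod_eq_one, mul_one]
    exact fun l _ => geometric_mul_one_sub (t l)
  have hvand : (Matrix.of fun c j => (Q j).coeff c.rev : Matrix (Fin m) (Fin m) R).det =
      ∏ i, ∏ j ∈ Finset.Ioi i, (t i - t j) := by
    have h := congrArg Matrix.det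
      (alternant_eq_coeffMatrix_mul hQ hE fun i : Fin m => (i.rev : ℕ))
    rw [Matrix.det_mul, det_coeffMatrix_rev h0, one_mul] at h
    rw [← h, ← Matrix.det_transpose]
    have hproj : (Matrix.of fun i j => t j ^ (i.rev : ℕ) : Matrix (Fin m) (Fin m) R).transpose =
        Matrix.projVandermonde 1 t := by
      ext i j
      simp [Matrix.projVandermonde_apply]
    rw [hproj, Matrix.det_projVandermonde]
    simp
  refine ⟨E, h0, ?_, fun w => ?_⟩
  · rw [hEdef, X_mul_derivative_prod _ fun j => X_mul_derivative_geometric (t j)]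
    congr 1
    ext n
    rw [map_sum]
    by_cases hn : n = 0 <;> simp [hn]
  · rw [alternant_eq_coeffMatrix_mul hQ hE w, Matrix.det_mul, hvand]

theorem coeffMatrix_mul {m : ℕ} (S : AddSubmonoid ℕ) {w : Fin m → ℕ} (hw : StrictAnti w)
    (hwS : ∀ i, w i ∉ S) (hgap : ∀ n ∉ S, ∃ i, w i = n) {U : PowerSeries R}
    (hU : ∀ n ∉ S, coeff n U = 0) (F : PowerSeries R) :
    coeffMatrix (U * F) w =
      Matrix.of (fun i j => if w j ≤ w i then coeff (w i - w j) U else 0) * coeffMatrix F w := by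
  ext i c
  rw [Matrix.mul_apply]
  simp only [coeffMatrix, Matrix.of_apply]
  rw [mul_assoc, coeff_mul, ← Finset.Nat.sum_antidiagonal_swap]
  simp only [Prod.fst_swap, Prod.snd_swap, ite_mul, zero_mul]
  rw [← Finset.sum_filter]
  symm
  refine Finset.sum_of_injOn (fun j => (w j, w i - w j)) ?_ ?_ ?_ ?_
  · intro j _ k _ h
    exact hw.injective (congrArg Prod.fst h)
  · intro j hj
    have hj : w j ≤ w i := by simpa using hj
    simpa using Nat.add_sub_cancel' hj
  · intro p hp hp'
    rw [Finset.HasAntidiagonal.mem_antidiagonal] at hp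
    by_cases h2 : p.2 ∈ S
    · have h1 : p.1 ∉ S := fun h1 => hwS i (hp ▸ S.add_mem h1 h2)
      obtain ⟨j, hj⟩ := hgap _ h1
      refine absurd ⟨j, ?_, ?_⟩ hp'
      · simp only [Finset.coe_filter, Finset.mem_univ, true_and, Set.mem_ofPred_eq]
        omega
      · ext <;> simp only <;> omega
    · rw [hU _ h2, zero_mul]
  · intro j _
    rfl

theorem det_coeffMatrix_mul {m : ℕ} (S : AddSubmonoid ℕ) {w : Fin m → ℕ} (hw : StrictAnti w)
    (hwS : ∀ i, w i ∉ S) (hgap : ∀ n ∉ S, ∃ i, w i = n) {U : PowerSeries R}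
    (hU : ∀ n ∉ S, coeff n U = 0) (hU0 : coeff 0 U = 1) (F : PowerSeries R) :
    (coeffMatrix (U * F) w).det = (coeffMatrix F w).det := by
  rw [coeffMatrix_mul S hw hwS hgap hU, Matrix.det_mul, Matrix.det_of_isUpperTriangular,
    Finset.prod_eq_one, one_mul]
  · intro i _
    rw [Matrix.of_apply, if_pos le_rfl, Nat.sub_self, hU0]
  · intro i j hij
    have hij : j < i := hij
    rw [Matrix.of_apply, if_neg (hw hij).not_ge]

/-- The alternant of the gap sequence `w` of a numerical semigroup is the Vandermonde product
times a polynomial in the power sums indexed by the gaps. -/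
theorem exists_mem_adjoin_det_alternant_gaps [Algebra ℚ R] {m : ℕ} (t : Fin m → R)
    (S : AddSubmonoid ℕ) {w : Fin m → ℕ} (hw : StrictAnti w)
    (hwS : ∀ i, w i ∉ S) (hgap : ∀ n ∉ S, ∃ i, w i = n) :
    ∃ x ∈ Algebra.adjoin ℚ (Set.range fun i => ∑ j, t j ^ w i),
      (Matrix.of fun i j => t j ^ w i : Matrix (Fin m) (Fin m) R).det =
        x * ∏ i, ∏ j ∈ Finset.Ioi i, (t i - t j) := by
  classical
  set A := Algebra.adjoin ℚ (Set.range fun i => ∑ j, t j ^ w i)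
  obtain ⟨E, hE0, hE, hdet⟩ := exists_det_alternant_eq t
  let a : PowerSeries R := mk fun n => if n ∈ S then 0 else ∑ j, t j ^ n
  let b : PowerSeries R := mk fun n => if n = 0 then 0 else if n ∈ S then ∑ j, t j ^ n else 0
  have ha0 : coeff 0 a = 0 := by
    rw [coeff_mk, if_pos S.zero_mem]
  have hb0 : coeff 0 b = 0 := by
    rw [coeff_mk, if_pos rfl]
  obtain ⟨F, hF0, hF⟩ := exists_X_mul_derivative_eq a ha0
  obtain ⟨U, hU0, hU⟩ := exists_X_mul_derivative_eq b hb0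
  have hEUF : E = U * F := by
    refine eq_of_X_mul_derivative_eq (by rw [coeff_mk, if_pos rfl]) hE ?_ ?_
    · rw [X_mul_derivative_mul hU hF]
      congr 1
      ext n
      simp only [a, b, map_add, coeff_mk]
      rcases eq_or_ne n 0 with rfl | hn
      · simp
      · by_cases h : n ∈ S <;> simp [h, hn]
    · simp only [coeff_zero_eq_constantCoeff] at hE0 hU0 hF0 ⊢
      rw [hE0, map_mul, hU0, hF0, one_mul]
  have hUS : ∀ n ∉ S, coeff n U = 0 :=
    coeff_eq_zero_of_X_mul_derivative_eq S hU hb0 fun n hn => by simp [b, hn]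
  have hFA : ∀ n, coeff n F ∈ A := by
    refine coeff_mem_of_X_mul_derivative_eq A hF ha0 hF0 fun n => ?_
    rw [coeff_mk]
    split_ifs with h
    · exact A.zero_mem
    · obtain ⟨i, rfl⟩ := hgap n h
      exact Algebra.subset_adjoin ⟨i, rfl⟩
  refine ⟨(coeffMatrix F w).det, ?_, ?_⟩
  · rw [Matrix.det_apply]
    refine A.sum_mem fun σ _ => ?_
    rw [Units.smul_def]
    refine zsmul_mem (A.prod_mem fun i _ => ?_) _
    rw [coeffMatrix, Matrix.of_apply, coeff_mul_X_pow']
    split_ifs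
    · exact hFA _
    · exact A.zero_mem
  · rw [hdet, hEUF, det_coeffMatrix_mul S hw hwS hgap hUS hU0]

end Alternant

section Semigroup

/-- The numerical semigroup generated by `r` and `s`. -/
def sgSubmonoid (r s : ℕ) : AddSubmonoid ℕ where
  carrier := {n | inSg r s n}
  zero_mem' := ⟨0, 0, by simp⟩
  add_mem' := by
    rintro _ _ ⟨a, b, rfl⟩ ⟨c, d, rfl⟩
    exact ⟨a + c, b + d, by ring⟩

theorem mem_sgSubmonoid {r s n : ℕ} : n ∈ sgSubmonoid r s ↔ inSg r s n := Iff.rfl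

variable {r s : ℕ}

theorem exists_eq_mul_add_mul (hco : Nat.Coprime r s) (hs : 0 < s) (n : ℤ) :
    ∃ a b : ℤ, 0 ≤ a ∧ a < s ∧ n = a * r + b * s := by
  obtain ⟨u, v, h⟩ := (Nat.isCoprime_iff_coprime.mpr hco : IsCoprime (r : ℤ) s)
  have hs' : (0 : ℤ) < s := by exact_mod_cast hs
  refine ⟨(n * u) % s, n * v + (n * u) / s * r, Int.emod_nonneg _ hs'.ne',
    Int.emod_lt_of_pos _ hs', ?_⟩
  have := Int.emod_add_mul_ediv (n * u) s
  linear_combination (-n) * h - (r : ℤ) * this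

theorem inSg_iff_nonneg (hco : Nat.Coprime r s) {n : ℕ} {a b : ℤ} (ha : 0 ≤ a) (has : a < s)
    (hn : (n : ℤ) = a * r + b * s) : inSg r s n ↔ 0 ≤ b := by
  constructor
  · rintro ⟨c, d, rfl⟩
    push_cast at hn
    have hdvd : (s : ℤ) ∣ (c - a) * r := ⟨b - d, by linear_combination hn⟩
    have hdvd' : (s : ℤ) ∣ c - a :=
      (Nat.isCoprime_iff_coprime.mpr hco.symm : IsCoprime (s : ℤ) r).dvd_of_dvd_mul_right hdvd
    obtain ⟨k, hk⟩ := hdvd'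
    have hs' : (0 : ℤ) < s := ha.trans_lt has
    have hc : (c : ℤ) = a + s * k := by linear_combination hk
    have hk0 : 0 ≤ k := by
      by_contra! hk0
      nlinarith [Int.natCast_nonneg c]
    have hb : b = d + k * r := by
      apply mul_right_cancel₀ hs'.ne'
      rw [hc] at hn
      linear_combination -hn
    rw [hb]
    positivity
  · intro hb
    lift a to ℕ using ha
    lift b to ℕ using hb
    exact ⟨a, b, by exact_mod_cast hn⟩

theorem inSg_sub_iff {g : ℕ} (hr : 0 < r) (hs : 0 < s) (hco : Nat.Coprime r s)
    (hg : 2 * g = (r - 1) * (s - 1)) {n : ℕ} (hn : n < 2 * g) :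
    inSg r s (2 * g - 1 - n) ↔ ¬ inSg r s n := by
  obtain ⟨a, b, ha, has, hab⟩ := exists_eq_mul_add_mul hco hs n
  have hg' : (2 * g : ℤ) = (r - 1) * (s - 1) := by
    have := congrArg (Nat.cast : ℕ → ℤ) hg
    push_cast [Nat.cast_sub (show 1 ≤ r from hr), Nat.cast_sub (show 1 ≤ s from hs)] at this
    exact this
  have hsub : ((2 * g - 1 - n : ℕ) : ℤ) = (s - 1 - a) * r + (-1 - b) * s := by
    have : ((2 * g - 1 - n : ℕ) : ℤ) = 2 * g - 1 - n := by omega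
    rw [this]
    linear_combination hg' - hab
  rw [inSg_iff_nonneg hco ha has hab,
    inSg_iff_nonneg hco (by omega) (by omega) hsub]
  omega

theorem inSg_of_two_mul_le {g : ℕ} (hr : 0 < r) (hs : 0 < s) (hco : Nat.Coprime r s)
    (hg : 2 * g = (r - 1) * (s - 1)) {n : ℕ} (hn : 2 * g ≤ n) : inSg r s n := by
  obtain ⟨a, b, ha, has, hab⟩ := exists_eq_mul_add_mul hco hs n
  rw [inSg_iff_nonneg hco ha has hab]
  have hg' : (2 * g : ℤ) = (r - 1) * (s - 1) := by
    have := congrArg (Nat.cast : ℕ → ℤ) hg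
    push_cast [Nat.cast_sub (show 1 ≤ r from hr), Nat.cast_sub (show 1 ≤ s from hs)] at this
    exact this
  have hn' : (2 * g : ℤ) ≤ n := by exact_mod_cast hn
  by_contra! hb
  have hr' : (0 : ℤ) < r := by exact_mod_cast hr
  have hs' : (0 : ℤ) < s := by exact_mod_cast hs
  nlinarith [mul_le_mul_of_nonneg_right (show a ≤ s - 1 by omega) hr'.le,
    mul_le_mul_of_nonneg_right (show b ≤ -1 by omega) hs'.le]

theorem card_filter_inSg {g : ℕ} [DecidablePred (inSg r s)] (hr : 0 < r) (hs : 0 < s)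
    (hco : Nat.Coprime r s) (hg : 2 * g = (r - 1) * (s - 1)) :
    ((Finset.range (2 * g)).filter (inSg r s)).card = g := by
  have h : ((Finset.range (2 * g)).filter (inSg r s)).card =
      ((Finset.range (2 * g)).filter fun n => ¬ inSg r s n).card := by
    refine Finset.card_bij' (fun n _ => 2 * g - 1 - n) (fun n _ => 2 * g - 1 - n) ?_ ?_ ?_ ?_
    · intro n hn
      rw [Finset.mem_filter, Finset.mem_range] at hn ⊢
      refine ⟨by omega, ?_⟩
      rw [inSg_sub_iff hr hs hco hg hn.1]
      exact not_not_intro hn.2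
    · intro n hn
      rw [Finset.mem_filter, Finset.mem_range] at hn ⊢
      exact ⟨by omega, (inSg_sub_iff hr hs hco hg hn.1).mpr hn.2⟩
    all_goals
      intro n hn
      rw [Finset.mem_filter, Finset.mem_range] at hn
      omega
  have := Finset.card_filter_add_card_filter_not (s := Finset.range (2 * g)) (inSg r s)
  rw [Finset.card_range] at this
  omega

theorem enumeration_lt_two_mul_iff {g : ℕ} {N : ℕ → ℕ} (hr : 0 < r) (hs : 0 < s)
    (hco : Nat.Coprime r s) (hg : 2 * g = (r - 1) * (s - 1)) (hmono : StrictMono N)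
    (hmem : ∀ n, inSg r s (N n)) (hsurj : ∀ m, inSg r s m → ∃ n, N n = m) (i : ℕ) :
    N i < 2 * g ↔ i < g := by
  classical
  obtain ⟨k, hk⟩ := hsurj _ (inSg_of_two_mul_le hr hs hco hg le_rfl)
  have hlt : ∀ i, N i < 2 * g ↔ i < k := fun i => by rw [← hk, hmono.lt_iff_lt]
  have himage : (Finset.range k).image N = (Finset.range (2 * g)).filter (inSg r s) := by
    ext n
    simp only [Finset.mem_image, Finset.mem_filter, Finset.mem_range]
    constructor
    · rintro ⟨i, hi, rfl⟩
      exact ⟨(hlt i).mpr hi, hmem i⟩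
    · rintro ⟨hn, hS⟩
      obtain ⟨i, rfl⟩ := hsurj n hS
      exact ⟨i, (hlt i).mp hn, rfl⟩
  have hcard := congrArg Finset.card himage
  rw [card_filter_inSg hr hs hco hg, Finset.card_image_of_injective _ hmono.injective,
    Finset.card_range] at hcard
  rw [hlt, hcard]

theorem Lam_add_sub_eq {g : ℕ} {N : ℕ → ℕ} (hmono : StrictMono N)
    (hN : ∀ i < g, N i < 2 * g) {i : ℕ} (hi : i < g) :
    Lam g N (i + 1) + g - (i + 1) = 2 * g - 1 - N i := by
  have hstep : ∀ d, N i + d ≤ N (i + d) := by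
    intro d
    induction d with
    | zero => exact le_rfl
    | succ d ih => exact Nat.succ_le_of_lt (ih.trans_lt (hmono (Nat.lt_succ_self _)))
  have h1 := hstep (g - 1 - i)
  have h2 := hN (i + (g - 1 - i)) (by omega)
  simp only [Lam, Nat.add_sub_cancel]
  omega

end Semigroup

theorem sum_Icc_one_eq_sum_fin {M : Type*} [AddCommMonoid M] (m : ℕ) (f : ℕ → M) :
    ∑ j ∈ Finset.Icc 1 m, f j = ∑ j : Fin m, f (j + 1) := by
  rw [Fin.sum_univ_eq_sum_range fun j => f (j + 1), Finset.range_eq_Ico,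
    Finset.sum_Ico_add' f 0 m 1]
  rfl

theorem vand_eq (m : ℕ) :
    vand m = ∏ i : Fin m, ∏ j ∈ Finset.Ioi i,
      ((MvPolynomial.X ((i : ℕ) + 1) : MvPolynomial ℕ ℚ) - MvPolynomial.X ((j : ℕ) + 1)) := by
  rw [Finset.prod_comm' (t' := Finset.univ) (s' := Finset.Iio) (by simp), vand]
  symm
  refine Finset.prod_bij' (fun j _ => (j : ℕ) + 1)
    (fun j hj => ⟨j - 1, by rw [Finset.mem_Icc] at hj; omega⟩) ?_ ?_ ?_ ?_ ?_
  · intro j _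
    rw [Finset.mem_Icc]
    omega
  · simp
  · simp
  · intro j hj
    rw [Finset.mem_Icc] at hj
    exact Nat.sub_add_cancel hj.1
  · intro j _
    refine Finset.prod_bij' (fun i _ => (i : ℕ) + 1)
      (fun i hi => ⟨i - 1, by rw [Finset.mem_Ico] at hi; omega⟩) ?_ ?_ ?_ ?_ ?_
    · intro i hi
      have hi : i < j := by simpa using hi
      rw [Finset.mem_Ico]
      omega
    · intro i hi
      rw [Finset.mem_Ico] at hi
      rw [Finset.mem_Iio, Fin.lt_def]
      simp only
      omega
    · simp
    · intro i hi
      rw [Finset.mem_Ico] at hi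
      exact Nat.sub_add_cancel hi.1
    · simp

theorem vand_ne_zero (m : ℕ) : vand m ≠ 0 := by
  refine Finset.prod_ne_zero_iff.mpr fun j _ => Finset.prod_ne_zero_iff.mpr fun i hi => ?_
  rw [Finset.mem_Ico] at hi
  exact sub_ne_zero.mpr fun h => hi.2.ne (MvPolynomial.X_injective h)

/-- The Schur polynomial `s_Λ(t_1, …, t_g)` of the gap partition `Λ` is a
polynomial in the power sums `T_{Λ_i + g - i}` (the Weierstrass gaps):
any `s_Λ` satisfying the defining determinant identity is of the form
`P(T_{Λ_1+g-1}, …, T_{Λ_g})` for some `P ∈ ℚ[X_1, …, X_g]`. -/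
theorem schur_polynomial_in_gap_power_sums (r s g : ℕ) (N : ℕ → ℕ)
    (hr : 2 ≤ r) (hrs : r < s) (hco : Nat.Coprime r s)
    (hg : 2 * g = (r - 1) * (s - 1))
    (hmono : StrictMono N)
    (hmem : ∀ n, inSg r s (N n))
    (hsurj : ∀ m, inSg r s m → ∃ n, N n = m) :
    ∀ sL : MvPolynomial ℕ ℚ,
      (tMat g (Lam g N)).det = sL * vand g →
      ∃ P : MvPolynomial (Fin g) ℚ,
        sL = MvPolynomial.aeval
          (fun i : Fin g => Tpow g (Lam g N (i.val + 1) + g - (i.val + 1)))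
          P := by
  intro sL hsL
  have hr0 : 0 < r := by omega
  have hs0 : 0 < s := by omega
  have hN := enumeration_lt_two_mul_iff hr0 hs0 hco hg hmono hmem hsurj
  set w : Fin g → ℕ := fun i => Lam g N (i.val + 1) + g - (i.val + 1)
  have hwN : ∀ i : Fin g, w i = 2 * g - 1 - N i := fun i =>
    Lam_add_sub_eq hmono (fun i => (hN i).mpr) i.2
  have hNi : ∀ i : Fin g, N i < 2 * g := fun i => (hN i).mpr i.2
  have hw : StrictAnti w := by
    intro i j hij
    have := hmono (show (i : ℕ) < j from hij)
    have := hNi j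
    rw [hwN, hwN]
    omega
  have hwS : ∀ i, w i ∉ sgSubmonoid r s := by
    intro i
    rw [hwN, mem_sgSubmonoid, inSg_sub_iff hr0 hs0 hco hg (hNi i)]
    exact not_not_intro (hmem i)
  have hgap : ∀ n ∉ sgSubmonoid r s, ∃ i, w i = n := by
    intro n hn
    rw [mem_sgSubmonoid] at hn
    have hlt : n < 2 * g := by
      by_contra! h
      exact hn (inSg_of_two_mul_le hr0 hs0 hco hg h)
    obtain ⟨i, hi⟩ := hsurj _ ((inSg_sub_iff hr0 hs0 hco hg hlt).mpr hn)
    refine ⟨⟨i, (hN i).mp (by omega)⟩, ?_⟩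
    rw [hwN]
    simp only [hi]
    omega
  obtain ⟨x, hx, hdet⟩ := exists_mem_adjoin_det_alternant_gaps
    (fun j : Fin g => (MvPolynomial.X (j + 1) : MvPolynomial ℕ ℚ)) _ hw hwS hgap
  have hsx : sL = x := by
    rw [← vand_eq] at hdet
    exact mul_right_cancel₀ (vand_ne_zero g) (hsL.symm.trans hdet)
  have hxT : x ∈ Algebra.adjoin ℚ (Set.range fun i => Tpow g (w i)) := by
    refine Algebra.adjoin_le ?_ hx
    rintro _ ⟨i, rfl⟩
    have hwi : (w i : ℚ) ≠ 0 :=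
      Nat.cast_ne_zero.mpr fun h => hwS i (h ▸ (sgSubmonoid r s).zero_mem)
    have hT : ∑ j : Fin g, (MvPolynomial.X (j + 1) : MvPolynomial ℕ ℚ) ^ w i =
        (w i : ℚ) • Tpow g (w i) := by
      rw [Tpow, smul_smul, mul_inv_cancel₀ hwi, one_smul,
        sum_Icc_one_eq_sum_fin g fun j => (MvPolynomial.X j : MvPolynomial ℕ ℚ) ^ w i]
    rw [SetLike.mem_coe]
    beta_reduce
    rw [hT]
    exact Subalgebra.smul_mem _ (Algebra.subset_adjoin (Set.mem_range_self i)) _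
  rw [Algebra.adjoin_range_eq_range_aeval] at hxT
  obtain ⟨P, hP⟩ := hxT
  exact ⟨P, hsx.trans hP.symm⟩
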